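/- Let R be a commutative integral domain, t,s units of R, c₀ ∈ R, and define a*b = t·a + s·b + c₀ for a,b ∈ R. Then the Moufang identity B15, namely x*(y*(x*z)) = ((x*y)*x)*z for all x,y,z ∈ R, holds if and only if t = 1 and s = 1 (with no restriction on c₀). -/

import Mathlib

/-- The affine operation `a * b = t·a + s·b + c₀` on a commutative integral domain. -/
def affOp {R : Type*} [CommRing R] (t s c₀ : R) (a b : R) : R := t * a + s * b + c₀

/-- An affine quasigroup over an integral domain satisfies the Moufang identity B15,
`x(y(xz)) = ((xy)x)z`, iff `t = 1` and `s = 1`. -/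
theorem affine_B15_iff {R : Type*} [CommRing R] [IsDomain R]
    (t s c₀ : R) (ht : IsUnit t) (hs : IsUnit s) :
    (∀ x y z : R,
        affOp t s c₀ x (affOp t s c₀ y (affOp t s c₀ x z)) =
          affOp t s c₀ (affOp t s c₀ (affOp t s c₀ x y) x) z) ↔
      (t = 1 ∧ s = 1) := by
  constructor
  · intro h
    have h0 := h 0 0 0
    have hx := h 1 0 0
    have hy := h 0 1 0
    have hz := h 0 0 1
    simp only [affOp] at h0 hx hy hz
    have t1 : t = 1 := by
      apply (ht.mul hs).mul_left_cancel
      linear_combination h0 - hy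
    subst t1
    have s2 : s * s = 1 := by
      apply hs.mul_left_cancel
      linear_combination hz - h0
    refine ⟨rfl, ?_⟩
    linear_combination s2 - hx + h0
  · rintro ⟨rfl, rfl⟩ x y z
    simp only [affOp]
    ring
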